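/- Let A be an Artin group whose defining graph Γ has an edge (a,b) labelled n. Then the map from the two-generator Artin group A_n = ⟨a,b | (aba⋯)_n = (bab⋯)_n⟩ to A sending generators to generators is injective; i.e., the special subgroup of A generated by a and b is naturally isomorphic to the Artin group on the induced subgraph. -/

import Mathlib

/-- The alternating product `x y x y ⋯` of length `n`. -/
def altG {G : Type*} [Monoid G] : ℕ → G → G → G
  | 0, _, _ => 1
  | n + 1, x, y => x * altG n y x

lemma map_altG {M N : Type*} [Monoid M] [Monoid N] (f : M →* N) :
    ∀ (n : ℕ) (x y : M), f (altG n x y) = altG n (f x) (f y)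
  | 0, _, _ => by simp [altG]
  | n + 1, x, y => by simp [altG, map_altG f n]

/-- The braid relation of the two-generator Artin group with exponent `n`. -/
def braidRels (n : ℕ) : Set (FreeGroup Bool) :=
  {altG n (FreeGroup.of true) (FreeGroup.of false) *
    (altG n (FreeGroup.of false) (FreeGroup.of true))⁻¹}

/-- The two-generator Artin group `A_n`. -/
abbrev ArtinTwo (n : ℕ) := PresentedGroup (braidRels n)

/-- The generator `a`. -/
def artinA (n : ℕ) : ArtinTwo n := PresentedGroup.of true

/-- The generator `b`. -/
def artinB (n : ℕ) : ArtinTwo n := PresentedGroup.of false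

/-- The Garside element `Δ = (aba⋯)_n`. -/
def artinDelta (n : ℕ) : ArtinTwo n := altG n (artinA n) (artinB n)

/-- The homomorphism `A_n → ℤ/2` sending both generators to `1`. -/
def toZ2 (n : ℕ) : ArtinTwo n →* Multiplicative (ZMod 2) :=
  PresentedGroup.toGroup (f := fun _ => Multiplicative.ofAdd 1) (by
    intro r hr
    simp only [braidRels, Set.mem_singleton_iff] at hr
    subst hr
    simp [map_altG])

/-- The index-two subgroup `A_n'` of even-length words. -/
def AnPrime (n : ℕ) : Subgroup (ArtinTwo n) := (toZ2 n).ker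

/-- The Artin relators of a labelled defining graph: for each pair `i, j` with finite
label `m i j ≥ 2` (label `0` or `1` means no edge / no relation), the relator
`(ij⋯)_{m i j} ((ji⋯)_{m i j})⁻¹`. -/
def artinRels {S : Type*} (m : S → S → ℕ) : Set (FreeGroup S) :=
  ⋃ (i : S) (j : S) (_ : 2 ≤ m i j),
    {altG (m i j) (FreeGroup.of i) (FreeGroup.of j) *
      (altG (m i j) (FreeGroup.of j) (FreeGroup.of i))⁻¹}

/-- The Artin group of a labelled defining graph. -/
abbrev ArtinGroup {S : Type*} (m : S → S → ℕ) := PresentedGroup (artinRels m)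

namespace CoxeterMatrix

open Real Polynomial.Chebyshev

variable {B : Type*} (M : CoxeterMatrix B)

/-- The coroot of a simple root in the geometric representation on `B →₀ ℝ`. -/
noncomputable def simpleCoroot (i : B) : Module.Dual ℝ (B →₀ ℝ) :=
  Finsupp.linearCombination ℝ fun j => -2 * cos (π / M i j)

lemma simpleCoroot_single (i j : B) :
    M.simpleCoroot i (Finsupp.single j 1) = -2 * cos (π / M i j) := by
  simp [simpleCoroot]

lemma simpleCoroot_single_self (i : B) : M.simpleCoroot i (Finsupp.single i 1) = 2 := by
  simp [simpleCoroot_single]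

/-- The action of a simple reflection in the geometric representation. -/
noncomputable def geomReflection (i : B) : (B →₀ ℝ) ≃ₗ[ℝ] (B →₀ ℝ) :=
  Module.reflection (M.simpleCoroot_single_self i)

lemma chebyshev_param (i j : B) :
    2 * cos (2 * π / M i j) = M.simpleCoroot i (Finsupp.single j 1) *
      M.simpleCoroot j (Finsupp.single i 1) - 2 := by
  rw [simpleCoroot_single, simpleCoroot_single, M.symmetric j i, mul_div_assoc, cos_two_mul]
  ring

lemma sin_two_pi_div_pos {m : ℕ} (hm : 3 ≤ m) : 0 < sin (2 * π / m) := by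
  have hm' : (3 : ℝ) ≤ m := by exact_mod_cast hm
  apply sin_pos_of_pos_of_lt_pi (by positivity)
  rw [div_lt_iff₀ (by positivity)]
  nlinarith [pi_pos]

lemma geomReflection_apply (i : B) (v : B →₀ ℝ) :
    M.geomReflection i v = v - M.simpleCoroot i v • Finsupp.single i 1 := by
  rw [geomReflection, Module.reflection_apply]

lemma geomReflection_mul_pow (i j : B) :
    (M.geomReflection i * M.geomReflection j) ^ M i j = 1 := by
  by_cases hij : i = j
  · subst hij
    ext1 v
    simp only [diagonal, pow_one, LinearEquiv.mul_apply, geomReflection]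
    exact Module.involutive_reflection _ v
  have h1 := M.off_diagonal i j hij
  obtain h | h | h : M i j = 0 ∨ M i j = 2 ∨ 3 ≤ M i j := by
    have : M i j ≠ 1 := h1
    omega
  · simp [h]
  · have hji : M j i = 2 := M.symmetric j i ▸ h
    have e1 : M.simpleCoroot i (Finsupp.single j 1) = 0 := by simp [simpleCoroot_single, h]
    have e2 : M.simpleCoroot j (Finsupp.single i 1) = 0 := by simp [simpleCoroot_single, hji]
    ext1 v
    rw [h, pow_two]
    simp only [LinearEquiv.mul_apply, geomReflection_apply, map_sub, map_smul, e1, e2,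
      simpleCoroot_single_self]
    simp only [LinearEquiv.coe_one, id]
    module
  · have hs := (sin_two_pi_div_pos h).ne'
    have hm0 : (M i j : ℝ) ≠ 0 := by
      have : M i j ≠ 0 := by omega
      exact_mod_cast this
    have S_eq (k : ℤ) : (S ℝ k).eval (2 * cos (2 * π / M i j)) =
        sin ((k + 1) * (2 * π / M i j)) / sin (2 * π / M i j) := by
      rw [eq_div_iff hs, S_two_mul_real_cos]
    ext1 v
    rw [geomReflection, geomReflection, Module.reflection_mul_reflection_pow_apply _ _ _ _
      (2 * cos (2 * π / M i j)) (M.chebyshev_param i j)]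
    obtain ⟨q, hq | hq⟩ := Nat.even_or_odd' (M i j)
    · have e1 : ((M i j : ℤ) - 2) / 2 = q - 1 := by omega
      have e2 : ((M i j : ℤ) - 1) / 2 = q - 1 := by omega
      have e3 : (S ℝ (q - 1)).eval (2 * cos (2 * π / M i j)) = 0 := by
        rw [S_eq, hq]
        have : ((((q : ℤ) - 1 : ℤ) : ℝ) + 1) * (2 * π / ((2 * q : ℕ) : ℝ)) = π := by
          have : (q : ℝ) ≠ 0 := by
            rintro h0
            apply hm0
            rw [hq]
            simp [h0]
          push_cast
          field_simp
          ring
        rw [this, sin_pi, zero_div]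
      rw [e1, e2, e3]
      simp
    · have e1 : ((M i j : ℤ) - 2) / 2 = q - 1 := by omega
      have e2 : ((M i j : ℤ) - 1) / 2 = q := by omega
      have e4 : ((M i j : ℤ) - 3) / 2 = q - 1 := by omega
      have e5 : (M i j : ℤ) / 2 = q := by omega
      have e3 : (S ℝ q).eval (2 * cos (2 * π / M i j)) +
          (S ℝ (q - 1)).eval (2 * cos (2 * π / M i j)) = 0 := by
        rw [S_eq, S_eq, hq]
        have : (((q : ℤ) : ℝ) + 1) * (2 * π / ((2 * q + 1 : ℕ) : ℝ)) =
            2 * π - ((((q : ℤ) - 1 : ℤ) : ℝ) + 1) * (2 * π / ((2 * q + 1 : ℕ) : ℝ)) := by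
          push_cast
          field_simp
          ring
        rw [this, sin_two_pi_sub]
        ring
      rw [e1, e2, e4, e5, e3]
      simp

end CoxeterMatrix

namespace CoxeterSystem

open Real Polynomial.Chebyshev

variable {B : Type*} {M : CoxeterMatrix B} {W : Type*} [Group W] (cs : CoxeterSystem M W)

/-- The geometric representation of a Coxeter group. -/
noncomputable def geomRep : W →* ((B →₀ ℝ) ≃ₗ[ℝ] (B →₀ ℝ)) :=
  cs.lift ⟨M.geomReflection, M.geomReflection_mul_pow⟩

lemma geomRep_simple (i : B) : cs.geomRep (cs.simple i) = M.geomReflection i :=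
  cs.lift_apply_simple _ i

/-- The product of two distinct simple reflections has order (a multiple of) the matrix entry. -/
theorem dvd_of_simple_mul_simple_pow_eq_one {i j : B} (hij : i ≠ j) (hM : M i j ≠ 0) {k : ℕ}
    (h : (cs.simple i * cs.simple j) ^ k = 1) : M i j ∣ k := by
  have h1 := M.off_diagonal i j hij
  have hsingle : Finsupp.single i (1 : ℝ) j = 0 := by simp [hij]
  have hsingle' : Finsupp.single j (1 : ℝ) i = 0 := by simp [hij.symm]
  obtain h2 | h2 : M i j = 2 ∨ 3 ≤ M i j := by
    have : M i j ≠ 1 := h1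
    omega
  · rw [h2]
    by_contra hk
    obtain ⟨q, rfl⟩ := Nat.not_even_iff_odd.mp (fun he => hk he.two_dvd)
    have h3 := cs.simple_mul_simple_pow i j
    rw [h2] at h3
    rw [pow_succ, pow_mul, h3, one_pow, one_mul] at h
    have h4 := congrArg (fun g => cs.geomRep g (Finsupp.single i 1) i) h
    have hji : M j i = 2 := M.symmetric j i ▸ h2
    have e2 : M.simpleCoroot j (Finsupp.single i 1) = 0 := by
      simp [CoxeterMatrix.simpleCoroot_single, hji]
    simp only [map_mul, geomRep_simple, LinearEquiv.mul_apply, M.geomReflection_apply, e2,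
      map_one, zero_smul, sub_zero, M.simpleCoroot_single_self] at h4
    norm_num at h4
  · have hs := (CoxeterMatrix.sin_two_pi_div_pos h2).ne'
    have hm0 : (M i j : ℝ) ≠ 0 := by exact_mod_cast hM
    have hm3 : (3 : ℝ) ≤ M i j := by exact_mod_cast h2
    have h4 := congrArg (fun g => cs.geomRep g (Finsupp.single i 1)) h
    simp only [map_pow, map_mul, geomRep_simple, map_one, LinearEquiv.coe_one, id,
      CoxeterMatrix.geomReflection] at h4
    rw [Module.reflection_mul_reflection_pow_apply_self _ _ _
      (2 * cos (2 * π / M i j)) (M.chebyshev_param i j)] at h4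
    have hi := DFunLike.congr_fun h4 i
    have hj := DFunLike.congr_fun h4 j
    simp only [Finsupp.add_apply, Finsupp.smul_apply, hsingle, hsingle', Finsupp.single_eq_same,
      smul_eq_mul, mul_zero, mul_one, add_zero, zero_add, M.simpleCoroot_single] at hi hj
    have hc : cos (π / M j i) ≠ 0 := by
      rw [M.symmetric j i]
      apply (cos_pos_of_mem_Ioo ⟨_, _⟩).ne'
      · have : 0 < π / M i j := by positivity
        linarith [pi_pos]
      · rw [div_lt_div_iff₀ (by positivity) (by norm_num)]
        nlinarith [pi_pos]
    have hS : (S ℝ ((k : ℤ) - 1)).eval (2 * cos (2 * π / M i j)) = 0 := by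
      rcases mul_eq_zero.mp hj with h | h
      · exact h
      · exfalso
        apply hc
        linarith
    rw [hS, add_zero] at hi
    have s1 := S_two_mul_real_cos (2 * π / M i j) ((k : ℤ) - 1)
    have s2 := S_two_mul_real_cos (2 * π / M i j) (k : ℤ)
    rw [hS, zero_mul] at s1
    rw [hi, one_mul, add_mul, one_mul, sin_add] at s2
    have s3 : sin (((k : ℤ) : ℝ) * (2 * π / M i j)) = 0 := by
      rw [s1]
      push_cast
      ring_nf
    rw [s3, zero_mul, zero_add] at s2
    have hcos : cos (((k : ℤ) : ℝ) * (2 * π / M i j)) = 1 :=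
      mul_right_cancel₀ hs (by rw [one_mul, ← s2])
    obtain ⟨c, hc⟩ := (cos_eq_one_iff _).mp hcos
    have : (c * M i j : ℝ) = k := by
      have := pi_pos.ne'
      field_simp at hc
      push_cast at hc
      linarith
    have : (c * M i j : ℤ) = k := by exact_mod_cast this
    exact Int.natCast_dvd_natCast.mp ⟨c, by rw [← this]; ring⟩

end CoxeterSystem

namespace CoxeterSystem

variable {B : Type*} {M : CoxeterMatrix B} {W : Type*} [Group W] (cs : CoxeterSystem M W)

lemma simple_mul_rotation_pow (i j : B) (k : ℕ) :
    cs.simple j * (cs.simple i * cs.simple j) ^ k =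
      ((cs.simple i * cs.simple j) ^ k)⁻¹ * cs.simple j := by
  induction k with
  | zero => simp
  | succ k ih =>
    rw [pow_succ, ← mul_assoc, ih, ← pow_succ, pow_succ', mul_inv_rev]
    simp [mul_assoc]

open Classical in
/-- The action of a simple reflection on signed group elements, the sign changing exactly at the
simple reflection itself. -/
noncomputable def signedConj (i : B) : Function.End (W × ZMod 2) :=
  fun x => (cs.simple i * x.1 * cs.simple i, x.2 + if x.1 = cs.simple i then 1 else 0)

open Classical in
lemma signedConj_mul_pow_apply (i j : B) (k : ℕ) (x : W × ZMod 2) :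
    ((cs.signedConj i * cs.signedConj j) ^ k) x =
      ((cs.simple i * cs.simple j) ^ k * x.1 * ((cs.simple i * cs.simple j) ^ k)⁻¹,
        x.2 + ∑ q ∈ Finset.range (2 * k),
          if x.1 = cs.simple j * (cs.simple i * cs.simple j) ^ q then 1 else 0) := by
  induction k with
  | zero => simp; rfl
  | succ k ih =>
    have happ : ((cs.signedConj i * cs.signedConj j) ^ (k + 1)) x =
        cs.signedConj i (cs.signedConj j (((cs.signedConj i * cs.signedConj j) ^ k) x)) := by
      rw [pow_succ']; rfl
    rw [happ, ih]
    have hconj (c x y : W) : c * x * c⁻¹ = y ↔ x = c⁻¹ * y * c := by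
      constructor <;> rintro rfl <;> group
    have e1 : (cs.simple i * cs.simple j) ^ k * x.1 * ((cs.simple i * cs.simple j) ^ k)⁻¹ =
        cs.simple j ↔ x.1 = cs.simple j * (cs.simple i * cs.simple j) ^ (2 * k) := by
      rw [hconj, ← simple_mul_rotation_pow, mul_assoc, ← pow_add, two_mul]
    have e2 : cs.simple j * ((cs.simple i * cs.simple j) ^ k * x.1 *
        ((cs.simple i * cs.simple j) ^ k)⁻¹) * cs.simple j = cs.simple i ↔
        x.1 = cs.simple j * (cs.simple i * cs.simple j) ^ (2 * k + 1) := by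
      have h1 : cs.simple j * (cs.simple i * cs.simple j) ^ (2 * k + 1) =
          ((cs.simple i * cs.simple j) ^ k)⁻¹ * (cs.simple j * cs.simple i * cs.simple j) *
            (cs.simple i * cs.simple j) ^ k := by
        rw [mul_assoc (cs.simple j), ← mul_assoc _ (cs.simple j), ← simple_mul_rotation_pow,
          show 2 * k + 1 = k + 1 + k by ring, pow_add, pow_succ]
        simp only [mul_assoc]
      rw [h1, ← hconj]
      constructor
      · intro h
        simpa [mul_assoc] using congrArg (fun z => cs.simple j * z * cs.simple j) h
      · intro h
        rw [h]
        simp [mul_assoc]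
    simp only [signedConj, e1, e2]
    rw [show 2 * (k + 1) = 2 * k + 1 + 1 by ring, Finset.sum_range_succ, Finset.sum_range_succ]
    simp only [pow_succ' _ k, mul_inv_rev, inv_simple, mul_assoc, add_assoc]

lemma signedConj_isLiftable : M.IsLiftable cs.signedConj := by
  classical
  intro i j
  funext x
  rw [signedConj_mul_pow_apply, simple_mul_simple_pow, two_mul, Finset.sum_range_add]
  simp only [pow_add, simple_mul_simple_pow, one_mul, CharTwo.add_self_eq_zero]
  simp
  rfl

/-- The conjugation action on signed group elements. -/
noncomputable def signedConjHom : W →* Function.End (W × ZMod 2) :=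
  cs.lift ⟨cs.signedConj, cs.signedConj_isLiftable⟩

lemma signedConjHom_simple (i : B) : cs.signedConjHom (cs.simple i) = cs.signedConj i :=
  cs.lift_apply_simple _ i

lemma signedConjHom_mul_apply (u v : W) (x : W × ZMod 2) :
    cs.signedConjHom (u * v) x = cs.signedConjHom u (cs.signedConjHom v x) := by
  rw [map_mul]; rfl

lemma signedConjHom_apply (w : W) (x : W × ZMod 2) :
    cs.signedConjHom w x = (w * x.1 * w⁻¹, x.2 + (cs.signedConjHom w (x.1, 0)).2) := by
  induction w using cs.simple_induction_left generalizing x with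
  | one =>
    rw [map_one]
    change x = (1 * x.1 * 1⁻¹, x.2 + 0)
    simp
  | mul_simple_left w i ih =>
    rw [signedConjHom_mul_apply, signedConjHom_mul_apply, ih, ih (x.1, 0), signedConjHom_simple]
    simp [signedConj, mul_assoc, add_assoc]

/-- The parity with which `r` occurs in the left inversion sequence of a word for `w`. -/
noncomputable def inversionParity (w r : W) : ZMod 2 := (cs.signedConjHom w⁻¹ (r, 0)).2

lemma inversionParity_mul (u v r : W) : cs.inversionParity (u * v) r =
    cs.inversionParity u r + cs.inversionParity v (u⁻¹ * r * u) := by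
  rw [inversionParity, mul_inv_rev, signedConjHom_mul_apply, signedConjHom_apply,
    cs.signedConjHom_apply u⁻¹]
  simp [inversionParity]

@[simp] lemma inversionParity_one (r : W) : cs.inversionParity 1 r = 0 := by
  rw [inversionParity, inv_one, map_one]
  rfl

open Classical in
lemma inversionParity_simple (i : B) (r : W) :
    cs.inversionParity (cs.simple i) r = if r = cs.simple i then 1 else 0 := by
  simp [inversionParity, signedConjHom_simple, signedConj]

open Classical in
lemma inversionParity_simple_mul (i : B) (w r : W) : cs.inversionParity (cs.simple i * w) r =
    (if r = cs.simple i then 1 else 0) +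
      cs.inversionParity w (cs.simple i * r * cs.simple i) := by
  rw [inversionParity_mul, inversionParity_simple, inv_simple]

lemma inversionParity_simple_mul_self (i : B) (w : W) :
    cs.inversionParity (cs.simple i * w) (cs.simple i) =
      1 + cs.inversionParity w (cs.simple i) := by
  simp [inversionParity_simple_mul]

lemma mem_leftInvSeq_of_inversionParity_ne_zero (ω : List B) (r : W)
    (h : cs.inversionParity (cs.wordProd ω) r ≠ 0) : r ∈ cs.leftInvSeq ω := by
  induction ω generalizing r with
  | nil => simp at h
  | cons i ω ih =>
    rw [leftInvSeq, List.mem_cons]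
    by_cases hr : r = cs.simple i
    · exact Or.inl hr
    · rw [wordProd_cons, inversionParity_simple_mul, if_neg hr, zero_add] at h
      exact Or.inr (List.mem_map.mpr ⟨_, ih _ h, by simp [mul_assoc]⟩)

lemma isLeftInversion_of_inversionParity_ne_zero {w r : W} (h : cs.inversionParity w r ≠ 0) :
    cs.IsLeftInversion w r := by
  obtain ⟨ω, hω, rfl⟩ := cs.exists_isReduced w
  exact cs.isLeftInversion_of_mem_leftInvSeq hω
    (cs.mem_leftInvSeq_of_inversionParity_ne_zero ω r h)

lemma inversionParity_simple_eq_zero_iff {w : W} {i : B} :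
    cs.inversionParity w (cs.simple i) = 0 ↔ ¬ cs.IsLeftDescent w i := by
  constructor
  · intro h hd
    have h1 : cs.inversionParity (cs.simple i * w) (cs.simple i) ≠ 0 := by
      simp [inversionParity_simple_mul_self, h]
    have h2 := (cs.isLeftInversion_of_inversionParity_ne_zero h1).2
    rw [simple_mul_simple_cancel_left] at h2
    exact lt_asymm h2 hd
  · intro h
    by_contra h1
    exact h (cs.isLeftInversion_of_inversionParity_ne_zero h1).2

/-- The standard parabolic subgroup generated by the simple reflections indexed by `J`. -/
def parabolic (J : Set B) : Subgroup W where
  carrier := {u | ∃ τ : List B, (∀ i ∈ τ, i ∈ J) ∧ cs.wordProd τ = u}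
  one_mem' := ⟨[], by simp, by simp⟩
  mul_mem' := by
    rintro _ _ ⟨τ, hτ, rfl⟩ ⟨τ', hτ', rfl⟩
    refine ⟨τ ++ τ', fun i hi => ?_, cs.wordProd_append _ _⟩
    exact (List.mem_append.mp hi).elim (hτ i) (hτ' i)
  inv_mem' := by
    rintro _ ⟨τ, hτ, rfl⟩
    exact ⟨τ.reverse, fun i hi => hτ i (List.mem_reverse.mp hi), cs.wordProd_reverse τ⟩

lemma simple_mem_parabolic {J : Set B} {i : B} (hi : i ∈ J) : cs.simple i ∈ cs.parabolic J :=
  ⟨[i], by simpa using hi, by simp⟩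

lemma wordProd_eq_one_of_not_isLeftDescent {J : Set B} (τ : List B) (hτ : ∀ i ∈ τ, i ∈ J)
    (h : ∀ i ∈ J, ¬ cs.IsLeftDescent (cs.wordProd τ) i) : cs.wordProd τ = 1 := by
  induction hn : τ.length using Nat.strong_induction_on generalizing τ with
  | _ n ih =>
    cases τ with
    | nil => simp
    | cons t τ =>
      have ht := cs.inversionParity_simple_eq_zero_iff.mpr (h t (hτ t (by simp)))
      rw [wordProd_cons, inversionParity_simple_mul_self] at ht
      have hmem : cs.simple t ∈ cs.leftInvSeq τ := by
        apply cs.mem_leftInvSeq_of_inversionParity_ne_zero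
        intro h0
        simp [h0] at ht
      obtain ⟨j, hj, hjt⟩ := List.mem_iff_getElem.mp hmem
      have hprod : cs.wordProd (t :: τ) = cs.wordProd (τ.eraseIdx j) := by
        rw [wordProd_cons, ← hjt, ← List.getD_eq_getElem _ 1 hj, getD_leftInvSeq_mul_wordProd]
      rw [hprod] at h ⊢
      refine ih _ ?_ _ (fun i hi => hτ i (List.mem_cons_of_mem _ (List.mem_of_mem_eraseIdx hi)))
        h rfl
      have := List.length_eraseIdx_le τ j
      simp only [List.length_cons] at hn
      omega

lemma eq_one_of_mem_parabolic {J : Set B} {u : W} (hu : u ∈ cs.parabolic J)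
    (h : ∀ i ∈ J, ¬ cs.IsLeftDescent u i) : u = 1 := by
  obtain ⟨τ, hτ, rfl⟩ := hu
  exact cs.wordProd_eq_one_of_not_isLeftDescent τ hτ h

/-- An element without left descents in `J` has no left inversions in the parabolic subgroup. -/
lemma inversionParity_eq_zero_of_mem_parabolic {J : Set B} {w : W}
    (hw : ∀ i ∈ J, ¬ cs.IsLeftDescent w i) {r : W} (hr : r ∈ cs.parabolic J) :
    cs.inversionParity w r = 0 := by
  let f : cs.parabolic J → ℕ := fun v => cs.length (v * w)
  set v := Function.argmin f with hv
  have hmin : ∀ v' : cs.parabolic J, cs.length (v * w) ≤ cs.length (v' * w) :=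
    fun v' => Function.argmin_le f v'
  have hzero : ∀ r ∈ cs.parabolic J, cs.inversionParity (v * w) r = 0 := by
    intro r hr
    by_contra h
    have h1 := (cs.isLeftInversion_of_inversionParity_ne_zero h).2
    have h2 := hmin (⟨r, hr⟩ * v)
    rw [Subgroup.coe_mul, mul_assoc] at h2
    exact absurd h1 (not_lt.mpr h2)
  have hsplit : ∀ r ∈ cs.parabolic J,
      cs.inversionParity w r = cs.inversionParity (v : W)⁻¹ r := by
    intro r hr
    have h1 := cs.inversionParity_mul (v : W)⁻¹ (v * w) r
    rw [inv_mul_cancel_left, hzero _ (mul_mem (mul_mem (by simp) hr) (by simp)), add_zero] at h1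
    exact h1
  have hv1 : (v : W)⁻¹ = 1 := by
    apply cs.eq_one_of_mem_parabolic (inv_mem v.2)
    intro i hi
    rw [← inversionParity_simple_eq_zero_iff, ← hsplit _ (cs.simple_mem_parabolic hi),
      inversionParity_simple_eq_zero_iff]
    exact hw i hi
  rw [hsplit r hr, hv1, inversionParity_one]

lemma isLeftDescent_mul_iff_of_mem_parabolic {J : Set B} {w : W}
    (hw : ∀ i ∈ J, ¬ cs.IsLeftDescent w i) {u : W} (hu : u ∈ cs.parabolic J) {i : B} (hi : i ∈ J) :
    cs.IsLeftDescent (u * w) i ↔ cs.IsLeftDescent u i := by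
  rw [← not_iff_not, ← inversionParity_simple_eq_zero_iff, ← inversionParity_simple_eq_zero_iff,
    inversionParity_mul, cs.inversionParity_eq_zero_of_mem_parabolic hw, add_zero]
  exact mul_mem (mul_mem (inv_mem hu) (cs.simple_mem_parabolic hi)) hu

/-- Minimal left coset representatives of a parabolic subgroup are unique. -/
lemma eq_of_mul_eq_mul_of_not_isRightDescent {J : Set B} {w w' u u' : W}
    (hw : ∀ i ∈ J, ¬ cs.IsRightDescent w i) (hw' : ∀ i ∈ J, ¬ cs.IsRightDescent w' i)
    (hu : u ∈ cs.parabolic J) (hu' : u' ∈ cs.parabolic J) (h : w * u = w' * u') :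
    w = w' ∧ u = u' := by
  have hmem : u * u'⁻¹ ∈ cs.parabolic J := mul_mem hu (inv_mem hu')
  have hw1 : u * u'⁻¹ * w'⁻¹ = w⁻¹ := by
    rw [mul_assoc, ← mul_inv_rev, ← h]
    simp
  have h1 : u * u'⁻¹ = 1 := by
    apply cs.eq_one_of_mem_parabolic hmem
    intro i hi
    rw [← cs.isLeftDescent_mul_iff_of_mem_parabolic (w := w'⁻¹) _ hmem hi, hw1,
      isLeftDescent_inv_iff]
    · exact hw i hi
    · intro i hi
      rw [isLeftDescent_inv_iff]
      exact hw' i hi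
  have h2 : u = u' := mul_inv_eq_one.mp h1
  subst h2
  exact ⟨mul_right_cancel h, rfl⟩

/-- The exchange condition for a right descent created by a left multiplication. -/
lemma simple_mul_eq_mul_simple {w : W} {i j : B} (hw : ¬ cs.IsRightDescent w j)
    (h : cs.IsRightDescent (cs.simple i * w) j) : cs.simple i * w = w * cs.simple j := by
  classical
  rw [← isLeftDescent_inv_iff, ← inversionParity_simple_eq_zero_iff] at hw
  rw [← isLeftDescent_inv_iff] at h
  by_contra hne
  refine cs.inversionParity_simple_eq_zero_iff.mp ?_ h
  rw [mul_inv_rev, inversionParity_mul, hw, inv_simple, inversionParity_simple, if_neg, add_zero]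
  intro h1
  apply hne
  rw [← h1]
  simp [mul_assoc]

end CoxeterSystem

section altG

variable {G : Type*} [Group G]

lemma altG_add {N : Type*} [Monoid N] (n k : ℕ) (x y : N) :
    altG (n + k) x y = altG n x y * if Even n then altG k x y else altG k y x := by
  induction n generalizing x y with
  | zero => simp [altG]
  | succ n ih =>
    rw [show n + 1 + k = n + k + 1 by ring, altG, altG, ih, mul_assoc]
    by_cases h : Even n <;> simp [h, Nat.even_add_one]

lemma altG_succ_right {N : Type*} [Monoid N] (n : ℕ) (x y : N) :
    altG (n + 1) x y = altG n x y * if Even n then x else y := by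
  rw [altG_add]
  simp [altG]

lemma altG_mul_comm {N : Type*} [Monoid N] {n : ℕ} {x y : N} (h : altG n x y = altG n y x)
    (c : ℕ) : altG (n * c) x y = altG (n * c) y x := by
  induction c with
  | zero => rfl
  | succ c ih =>
    rw [mul_add_one, add_comm, altG_add, altG_add, ih, h]

lemma commute_altG {N : Type*} [Monoid N] {x y z : N} (hx : Commute x z) (hy : Commute y z)
    (n : ℕ) : Commute (altG n x y) z := by
  induction n generalizing x y with
  | zero => exact Commute.one_left z
  | succ n ih => exact hx.mul_left (ih hy hx)

lemma altG_mul_inv_altG_swap {x y : G} (hx : x⁻¹ = x) (hy : y⁻¹ = y) (k : ℕ) :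
    altG k x y * (altG k y x)⁻¹ = (x * y) ^ k := by
  induction k generalizing x y with
  | zero => simp [altG]
  | succ k ih =>
    have h : SemiconjBy x (y * x) (x * y) := (mul_assoc x y x).symm
    rw [altG, altG, mul_inv_rev, hy, pow_succ, ← mul_assoc, mul_assoc x, ih hy hx,
      (h.pow_right k).eq, mul_assoc]

lemma altG_eq_swap_iff {x y : G} (hx : x⁻¹ = x) (hy : y⁻¹ = y) (k : ℕ) :
    altG k x y = altG k y x ↔ (x * y) ^ k = 1 := by
  rw [← altG_mul_inv_altG_swap hx hy, mul_inv_eq_one]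

end altG

namespace CoxeterSystem

variable {B : Type*} {M : CoxeterMatrix B} {W : Type*} [Group W] (cs : CoxeterSystem M W)

lemma altG_simple_eq_swap_iff (i j : B) (k : ℕ) :
    altG k (cs.simple i) (cs.simple j) = altG k (cs.simple j) (cs.simple i) ↔
      (cs.simple i * cs.simple j) ^ k = 1 :=
  altG_eq_swap_iff (cs.inv_simple i) (cs.inv_simple j) k

lemma altG_simple_mem_parabolic {J : Set B} {i j : B} (hi : i ∈ J) (hj : j ∈ J) (k : ℕ) :
    altG k (cs.simple i) (cs.simple j) ∈ cs.parabolic J := by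
  induction k generalizing i j with
  | zero => exact one_mem _
  | succ k ih => exact mul_mem (cs.simple_mem_parabolic hi) (ih hj hi)

lemma length_altG_simple_le (i j : B) (k : ℕ) :
    cs.length (altG k (cs.simple i) (cs.simple j)) ≤ k := by
  induction k generalizing i j with
  | zero => simp [altG]
  | succ k ih =>
    have h1 := cs.length_mul_le (cs.simple i) (altG k (cs.simple j) (cs.simple i))
    have h2 := ih j i
    rw [length_simple] at h1
    rw [altG]
    omega

lemma exists_eq_of_inversionParity_altG_ne_zero {i j : B} {k : ℕ} {r : W}
    (h : cs.inversionParity (altG k (cs.simple i) (cs.simple j)) r ≠ 0) :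
    ∃ q < k, r = cs.simple i * (cs.simple j * cs.simple i) ^ q := by
  classical
  induction k generalizing i j r with
  | zero => simp [altG] at h
  | succ k ih =>
    by_cases hr : r = cs.simple i
    · exact ⟨0, by simp, by simpa using hr⟩
    · rw [altG, inversionParity_simple_mul, if_neg hr, zero_add] at h
      obtain ⟨q, hq, h⟩ := ih h
      refine ⟨q + 1, by omega, ?_⟩
      have hr' : r = cs.simple i * (cs.simple i * r * cs.simple i) * cs.simple i := by
        simp [mul_assoc]
      have hsemi : SemiconjBy (cs.simple i) (cs.simple j * cs.simple i)
          (cs.simple i * cs.simple j) := (mul_assoc _ _ _).symm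
      rw [hr', h, (hsemi.pow_right (q + 1)).eq, pow_succ']
      simp only [mul_assoc]

lemma not_isLeftDescent_altG {i j : B} (hij : i ≠ j) {k : ℕ} (hk : k < M i j) :
    ¬ cs.IsLeftDescent (altG k (cs.simple j) (cs.simple i)) i := by
  rw [← inversionParity_simple_eq_zero_iff]
  by_contra h
  obtain ⟨q, hq, h⟩ := cs.exists_eq_of_inversionParity_altG_ne_zero h
  have h1 : (cs.simple i * cs.simple j) ^ (q + 1) = 1 := by
    rw [pow_succ', mul_assoc, ← h, simple_mul_simple_self]
  have := Nat.le_of_dvd (by omega)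
    (cs.dvd_of_simple_mul_simple_pow_eq_one hij (by omega) h1)
  omega

lemma length_altG_mul {i j : B} (hij : i ≠ j) {k : ℕ} (hk : k ≤ M i j) {w : W}
    (hi : ¬ cs.IsLeftDescent w i) (hj : ¬ cs.IsLeftDescent w j) :
    cs.length (altG k (cs.simple i) (cs.simple j) * w) = cs.length w + k := by
  induction k generalizing i j with
  | zero => simp [altG]
  | succ k ih =>
    have hJ : ∀ l ∈ ({i, j} : Set B), ¬ cs.IsLeftDescent w l := by
      rintro l (rfl | rfl) <;> assumption
    have hmem : altG k (cs.simple j) (cs.simple i) ∈ cs.parabolic {i, j} :=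
      cs.altG_simple_mem_parabolic (by simp) (by simp) k
    have h := (cs.isLeftDescent_mul_iff_of_mem_parabolic hJ hmem (Set.mem_insert i _)).not.mpr
      (cs.not_isLeftDescent_altG hij hk)
    rw [not_isLeftDescent_iff, ih hij.symm (by rw [M.symmetric]; omega) hj hi] at h
    rw [altG, mul_assoc, h, add_assoc]

end CoxeterSystem

/-- A group generated like a rank two standard parabolic subgroup of a Coxeter group, in which
the braid relation between the two generators holds, with its projection to the Coxeter group. -/
structure DihedralLift {B : Type*} {M : CoxeterMatrix B} {W : Type*} [Group W]
    (cs : CoxeterSystem M W) (A : Type*) [Group A] where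
  /-- The two simple reflections. -/
  idx : Bool → B
  /-- The two generators. -/
  gen : Bool → A
  /-- The projection to the Coxeter group. -/
  proj : A →* W
  proj_gen : ∀ x, proj (gen x) = cs.simple (idx x)
  proj_mem : ∀ g, proj g ∈ cs.parabolic (Set.range idx)
  altG_gen : ∀ x k, altG k (cs.simple (idx x)) (cs.simple (idx !x)) =
    altG k (cs.simple (idx !x)) (cs.simple (idx x)) →
      altG k (gen x) (gen !x) = altG k (gen !x) (gen x)

namespace DihedralLift

variable {B : Type*} {M : CoxeterMatrix B} {W : Type*} [Group W] {cs : CoxeterSystem M W}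
  {A : Type*} [Group A] (L : DihedralLift cs A)

/-- Minimal representatives of the left cosets of the parabolic subgroup. -/
abbrev MinRep : Type _ := {w : W // ∀ x, ¬ cs.IsRightDescent w (L.idx x)}

/-- A simple reflection fixes the coset of a minimal representative. -/
def Fixes (i : B) (w : L.MinRep) : Prop := ∃ x, cs.simple i * w.1 = w.1 * cs.simple (L.idx x)

open Classical in
/-- The minimal representative of the coset obtained by acting by a simple reflection. -/
noncomputable def next (i : B) (w : L.MinRep) : L.MinRep :=
  if h : L.Fixes i w then w
  else ⟨cs.simple i * w.1, fun x hx => h ⟨x, cs.simple_mul_eq_mul_simple (w.2 x) hx⟩⟩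

open Classical in
/-- The label of the edge from a coset to its image under a simple reflection. -/
noncomputable def label (i : B) (w : L.MinRep) : A :=
  if h : L.Fixes i w then L.gen h.choose else 1

variable {L}

lemma next_of_fixes {i : B} {w : L.MinRep} (h : L.Fixes i w) : L.next i w = w := dif_pos h

lemma next_of_not_fixes {i : B} {w : L.MinRep} (h : ¬ L.Fixes i w) :
    (L.next i w).1 = cs.simple i * w.1 := by
  rw [next, dif_neg h]

lemma fixes_of_next_eq {i : B} {w : L.MinRep} (h : L.next i w = w) : L.Fixes i w := by
  by_contra hw
  have h1 := next_of_not_fixes hw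
  rw [h, eq_comm, mul_eq_right] at h1
  simpa [h1] using cs.length_simple i

lemma label_of_not_fixes {i : B} {w : L.MinRep} (h : ¬ L.Fixes i w) : L.label i w = 1 :=
  dif_neg h

lemma exists_label_eq {i : B} {w : L.MinRep} (h : L.Fixes i w) :
    ∃ x, L.label i w = L.gen x ∧ cs.simple i * w.1 = w.1 * cs.simple (L.idx x) :=
  ⟨h.choose, dif_pos h, h.choose_spec⟩

lemma simple_mul_eq (i : B) (w : L.MinRep) :
    cs.simple i * w.1 = (L.next i w).1 * L.proj (L.label i w) := by
  by_cases h : L.Fixes i w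
  · obtain ⟨x, h1, h2⟩ := exists_label_eq h
    rw [h1, L.proj_gen, next_of_fixes h, h2]
  · rw [next_of_not_fixes h, label_of_not_fixes h, map_one, mul_one]

lemma fixes_next_iff {i : B} {w : L.MinRep} : L.Fixes i (L.next i w) ↔ L.Fixes i w := by
  by_cases h : L.Fixes i w
  · rw [next_of_fixes h]
  · refine iff_of_false (fun ⟨x, hx⟩ => h ⟨x, ?_⟩) h
    rw [next_of_not_fixes h, cs.simple_mul_simple_cancel_left] at hx
    nth_rewrite 2 [hx]
    simp

lemma next_next (i : B) (w : L.MinRep) : L.next i (L.next i w) = w := by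
  by_cases h : L.Fixes i w
  · rw [next_of_fixes h, next_of_fixes h]
  · apply Subtype.ext
    rw [next_of_not_fixes (fixes_next_iff.not.mpr h), next_of_not_fixes h,
      cs.simple_mul_simple_cancel_left]

lemma label_next (i : B) (w : L.MinRep) : L.label i (L.next i w) = L.label i w := by
  by_cases h : L.Fixes i w
  · rw [next_of_fixes h]
  · rw [label_of_not_fixes h, label_of_not_fixes (fixes_next_iff.not.mpr h)]

variable (L)

/-- The action of a generator of the Artin group on the pairs of a coset and an element of the
rank two group. -/
noncomputable def step (i : B) : Equiv.Perm (L.MinRep × A) where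
  toFun y := (L.next i y.1, L.label i y.1 * y.2)
  invFun y := (L.next i y.1, (L.label i y.1)⁻¹ * y.2)
  left_inv y := by simp [next_next, label_next]
  right_inv y := by simp [next_next, label_next]

/-- Right multiplication by an element of the rank two group. -/
def mulRightPerm (g : A) : Equiv.Perm (L.MinRep × A) :=
  Equiv.prodCongr (Equiv.refl _) (Equiv.mulRight g)

variable {L}

lemma step_apply (i : B) (w : L.MinRep) (g : A) :
    L.step i (w, g) = (L.next i w, L.label i w * g) := rfl

lemma mulRightPerm_apply (w : L.MinRep) (g h : A) : L.mulRightPerm h (w, g) = (w, g * h) := rfl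

lemma commute_step_mulRightPerm (i : B) (g : A) : Commute (L.step i) (L.mulRightPerm g) := by
  ext1 ⟨w, h⟩
  simp [step_apply, mulRightPerm_apply, mul_assoc]

lemma step_step_of_not_fixes {i : B} {y : L.MinRep × A} (h : ¬ L.Fixes i y.1) :
    L.step i (L.step i y) = y := by
  obtain ⟨w, g⟩ := y
  simp [step_apply, next_next, label_next, label_of_not_fixes h]

/-- The element of the Coxeter group represented by a coset and an element of the rank two
group. -/
def val (y : L.MinRep × A) : W := y.1.1 * L.proj y.2

lemma val_step (i : B) (y : L.MinRep × A) : val (L.step i y) = cs.simple i * val y := by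
  obtain ⟨w, g⟩ := y
  rw [step_apply, val, val, map_mul, ← mul_assoc, ← mul_assoc, simple_mul_eq]

lemma val_altG_step (i j : B) (k : ℕ) (y : L.MinRep × A) :
    val (altG k (L.step i) (L.step j) y) =
      altG k (cs.simple i) (cs.simple j) * val y := by
  induction k generalizing i j with
  | zero => simp [altG]
  | succ k ih => rw [altG, Equiv.Perm.mul_apply, val_step, ih, altG, mul_assoc]

lemma eq_of_val_eq_mul {y z : L.MinRep × A} {u : W} (hu : u ∈ cs.parabolic (Set.range L.idx))
    (h : val y = val z * u) : y.1 = z.1 ∧ L.proj y.2 = L.proj z.2 * u := by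
  rw [val, val, mul_assoc] at h
  obtain ⟨h1, h2⟩ := cs.eq_of_mul_eq_mul_of_not_isRightDescent (J := Set.range L.idx)
    (by rintro _ ⟨x, rfl⟩; exact y.1.2 x) (by rintro _ ⟨x, rfl⟩; exact z.1.2 x)
    (L.proj_mem _) (mul_mem (L.proj_mem _) hu) h
  exact ⟨Subtype.ext h1, h2⟩

lemma fixes_iff {i : B} {y : L.MinRep × A} :
    L.Fixes i y.1 ↔ ∃ u ∈ cs.parabolic (Set.range L.idx), cs.simple i * val y = val y * u := by
  constructor
  · intro h
    refine ⟨L.proj (y.2⁻¹ * L.label i y.1 * y.2), L.proj_mem _, ?_⟩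
    rw [← val_step, val, val, ← Prod.mk.eta (p := y), step_apply, next_of_fixes h]
    simp [mul_assoc]
  · rintro ⟨u, hu, h⟩
    rw [← val_step] at h
    exact fixes_of_next_eq (eq_of_val_eq_mul hu h).1

/-- The braid relation holds at all elements with a given coset. -/
def BraidAt (i j : B) (k : ℕ) (w : L.MinRep) : Prop :=
  ∀ g, altG k (L.step i) (L.step j) (w, g) = altG k (L.step j) (L.step i) (w, g)

lemma braidAt_of_one {i j : B} {k : ℕ} {w : L.MinRep}
    (h : altG k (L.step i) (L.step j) (w, 1) = altG k (L.step j) (L.step i) (w, 1)) :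
    L.BraidAt i j k w := by
  intro g
  have hg : ((w, g) : L.MinRep × A) = L.mulRightPerm g (w, 1) := by simp [mulRightPerm_apply]
  have hc (i j : B) : altG k (L.step i) (L.step j) (w, g) =
      L.mulRightPerm g (altG k (L.step i) (L.step j) (w, 1)) := by
    rw [hg, ← Equiv.Perm.mul_apply, ← Equiv.Perm.mul_apply,
      (commute_altG (commute_step_mulRightPerm i g) (commute_step_mulRightPerm j g) k).eq]
  rw [hc, hc, h]

lemma BraidAt.symm {i j : B} {k : ℕ} {w : L.MinRep} (h : L.BraidAt i j k w) : L.BraidAt j i k w :=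
  fun g => (h g).symm

lemma BraidAt.next_last {i j : B} {k : ℕ} {w : L.MinRep} (h : L.BraidAt i j (k + 1) w)
    (hW : altG (k + 1) (cs.simple i) (cs.simple j) = altG (k + 1) (cs.simple j) (cs.simple i)) :
    L.BraidAt i j (k + 1) (L.next (if Even k then i else j) w) := by
  set l := if Even k then i else j with hl
  by_cases hfix : L.Fixes l w
  · rwa [next_of_fixes hfix]
  intro g
  have hstep : (L.next l w, g) = L.step l (w, g) := by
    rw [step_apply, label_of_not_fixes hfix, one_mul]
  have hlast : altG (k + 1) (L.step i) (L.step j) =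
      altG k (L.step i) (L.step j) * L.step l := by
    rw [altG_succ_right, hl]
    split_ifs <;> rfl
  have hlastW : altG (k + 1) (cs.simple i) (cs.simple j) =
      altG k (cs.simple i) (cs.simple j) * cs.simple l := by
    rw [altG_succ_right, hl]
    split_ifs <;> rfl
  have hg := h g
  rw [hlast, altG, Equiv.Perm.mul_apply, Equiv.Perm.mul_apply] at hg
  rw [hlast, altG, Equiv.Perm.mul_apply, Equiv.Perm.mul_apply, hstep,
    step_step_of_not_fixes hfix, hg, step_step_of_not_fixes]
  rw [fixes_iff]
  rintro ⟨u, hu, hu'⟩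
  apply hfix
  change L.Fixes l (w, g).1
  rw [fixes_iff]
  refine ⟨u, hu, ?_⟩
  rw [hlastW, altG] at hW
  rw [val_altG_step, ← mul_assoc, ← hW, mul_assoc, mul_assoc] at hu'
  exact mul_left_cancel hu'

lemma BraidAt.next {i j : B} {k : ℕ} {w : L.MinRep} (h : L.BraidAt i j (k + 1) w)
    (hW : altG (k + 1) (cs.simple i) (cs.simple j) = altG (k + 1) (cs.simple j) (cs.simple i))
    {l : B} (hl : l = i ∨ l = j) : L.BraidAt i j (k + 1) (L.next l w) := by
  have h1 := h.next_last hW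
  have h2 := (h.symm.next_last hW.symm).symm
  by_cases hk : Even k
  · rw [if_pos hk] at h1 h2
    rcases hl with rfl | rfl <;> assumption
  · rw [if_neg hk] at h1 h2
    rcases hl with rfl | rfl <;> assumption

lemma exists_word_altG_step (i j : B) (w : L.MinRep) (k : ℕ) : ∃ τ : List Bool,
    (altG k (L.step i) (L.step j) (w, 1)).2 = (τ.map L.gen).prod ∧
      cs.length (altG k (L.step i) (L.step j) (w, 1)).1.1 + τ.length ≤ cs.length w.1 + k := by
  induction k generalizing i j with
  | zero => exact ⟨[], rfl, le_rfl⟩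
  | succ k ih =>
    obtain ⟨τ, h1, h2⟩ := ih j i
    rw [altG, Equiv.Perm.mul_apply]
    generalize altG k (L.step j) (L.step i) (w, 1) = y at h1 h2
    obtain ⟨v, g⟩ := y
    rw [step_apply]
    by_cases h : L.Fixes i v
    · obtain ⟨x, hx, -⟩ := exists_label_eq h
      refine ⟨x :: τ, by simp [hx, ← h1], ?_⟩
      rw [next_of_fixes h, List.length_cons]
      dsimp only at h2 ⊢
      omega
    · refine ⟨τ, by simpa [label_of_not_fixes h] using h1, ?_⟩
      have h3 := cs.length_mul_le (cs.simple i) v.1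
      rw [cs.length_simple, ← next_of_not_fixes h] at h3
      dsimp only at h2 ⊢
      omega

lemma length_proj_prod_le (τ : List Bool) :
    cs.length (L.proj (τ.map L.gen).prod) ≤ τ.length := by
  induction τ with
  | nil => simp
  | cons x τ ih =>
    have h := cs.length_mul_le (cs.simple (L.idx x)) (L.proj (τ.map L.gen).prod)
    rw [cs.length_simple] at h
    rw [List.map_cons, List.prod_cons, map_mul, L.proj_gen, List.length_cons]
    omega

/-- A reduced word in the generators of the rank two group is alternating. -/
lemma exists_prod_eq_altG {τ : List Bool}
    (h : τ.length ≤ cs.length (L.proj (τ.map L.gen).prod)) :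
    ∃ x, (τ.map L.gen).prod = altG τ.length (L.gen x) (L.gen !x) := by
  induction τ with
  | nil => exact ⟨true, rfl⟩
  | cons x τ ih =>
    rw [List.map_cons, List.prod_cons, map_mul, L.proj_gen, List.length_cons] at h
    have h1 := cs.length_mul_le (cs.simple (L.idx x)) (L.proj (τ.map L.gen).prod)
    rw [cs.length_simple] at h1
    obtain ⟨y, hy⟩ := ih (by omega)
    refine ⟨x, ?_⟩
    rw [List.map_cons, List.prod_cons, List.length_cons, altG, hy]
    by_cases hxy : y = x
    · subst hxy
      rcases hτ : τ.length with - | k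
      · rfl
      · exfalso
        rw [hy, hτ, altG, map_mul, L.proj_gen, cs.simple_mul_simple_cancel_left, map_altG,
          L.proj_gen, L.proj_gen] at h
        have := cs.length_altG_simple_le (L.idx !y) (L.idx y) k
        omega
    · rw [Bool.eq_not_of_ne hxy, Bool.not_not]

/-- Reduced words in the rank two group with the same projection are equal. -/
lemma prod_eq_prod {τ τ' : List Bool}
    (h : τ.length ≤ cs.length (L.proj (τ.map L.gen).prod))
    (h' : τ'.length ≤ cs.length (L.proj (τ'.map L.gen).prod))
    (heq : L.proj (τ.map L.gen).prod = L.proj (τ'.map L.gen).prod) :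
    (τ.map L.gen).prod = (τ'.map L.gen).prod := by
  have hlen : τ.length = τ'.length := by
    have h1 := L.length_proj_prod_le τ
    have h2 := L.length_proj_prod_le τ'
    rw [heq] at h h1
    omega
  obtain ⟨x, hx⟩ := exists_prod_eq_altG h
  obtain ⟨y, hy⟩ := exists_prod_eq_altG h'
  rw [hx, hy, hlen] at heq ⊢
  by_cases hxy : y = x
  · rw [hxy]
  · rw [Bool.eq_not_of_ne hxy, Bool.not_not] at heq ⊢
    apply L.altG_gen
    simpa only [map_altG, L.proj_gen] using heq

lemma braidAt_of_not_isLeftDescent {i j : B} (hij : i ≠ j) {w : L.MinRep}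
    (hi : ¬ cs.IsLeftDescent w.1 i) (hj : ¬ cs.IsLeftDescent w.1 j) :
    L.BraidAt i j (M i j) w := by
  have hred {i j : B} (hij : i ≠ j) (hi : ¬ cs.IsLeftDescent w.1 i)
      (hj : ¬ cs.IsLeftDescent w.1 j) : ∃ τ : List Bool,
      (altG (M i j) (L.step i) (L.step j) (w, 1)).2 = (τ.map L.gen).prod ∧
        τ.length ≤ cs.length (L.proj (τ.map L.gen).prod) := by
    obtain ⟨τ, h1, h2⟩ := exists_word_altG_step i j w (M i j)
    refine ⟨τ, h1, ?_⟩
    have h3 := val_altG_step i j (M i j) (w, (1 : A))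
    generalize altG (M i j) (L.step i) (L.step j) (w, 1) = y at h1 h2 h3
    have h4 := cs.length_altG_mul hij le_rfl hi hj
    have h5 := cs.length_mul_le y.1.1 (L.proj y.2)
    rw [val, val, map_one, mul_one] at h3
    rw [← h3] at h4
    rw [← h1]
    omega
  obtain ⟨τ, h1, h2⟩ := hred hij hi hj
  obtain ⟨τ', h1', h2'⟩ := hred hij.symm hj hi
  rw [M.symmetric j i] at h1'
  have hval : val (altG (M i j) (L.step i) (L.step j) (w, 1)) =
      val (altG (M i j) (L.step j) (L.step i) (w, 1)) * 1 := by
    rw [val_altG_step, val_altG_step, mul_one,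
      (cs.altG_simple_eq_swap_iff i j _).mpr (cs.simple_mul_simple_pow i j)]
  obtain ⟨h3, h4⟩ := eq_of_val_eq_mul (one_mem _) hval
  apply braidAt_of_one
  refine Prod.ext h3 ?_
  rw [mul_one, h1, h1'] at h4
  rw [h1, h1', prod_eq_prod h2 h2' h4]

lemma braidAt {i j : B} (hij : i ≠ j) (hM : M i j ≠ 0) (w : L.MinRep) :
    L.BraidAt i j (M i j) w := by
  induction hn : cs.length w.1 using Nat.strong_induction_on generalizing w with
  | _ n ih =>
    by_cases hdesc : ∃ l, (l = i ∨ l = j) ∧ cs.IsLeftDescent w.1 l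
    · obtain ⟨l, hl, hd⟩ := hdesc
      have hfix : ¬ L.Fixes l w := by
        rintro ⟨x, hx⟩
        rw [CoxeterSystem.IsLeftDescent, hx] at hd
        exact w.2 x hd
      have hlt : cs.length (L.next l w).1 < n := by
        rw [next_of_not_fixes hfix, ← hn]
        exact hd
      have h := ih _ hlt _ rfl
      have hW := (cs.altG_simple_eq_swap_iff i j _).mpr (cs.simple_mul_simple_pow i j)
      obtain ⟨k, hk⟩ := Nat.exists_eq_succ_of_ne_zero hM
      rw [hk] at h hW ⊢
      rw [← next_next l w]
      exact h.next hW hl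
    · push Not at hdesc
      exact braidAt_of_not_isLeftDescent hij (hdesc i (Or.inl rfl)) (hdesc j (Or.inr rfl))

lemma altG_step_eq {i j : B} (hij : i ≠ j) (hM : M i j ≠ 0) :
    altG (M i j) (L.step i) (L.step j) = altG (M i j) (L.step j) (L.step i) := by
  ext1 ⟨w, g⟩
  exact braidAt hij hM w g

variable (L) in
/-- The base coset. -/
def baseRep : L.MinRep := ⟨1, fun x h => by simp [CoxeterSystem.IsRightDescent] at h⟩

lemma step_idx_baseRep (hidx : Function.Injective fun x => cs.simple (L.idx x)) (x : Bool) (g : A) :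
    L.step (L.idx x) (L.baseRep, g) = (L.baseRep, L.gen x * g) := by
  have hfix : L.Fixes (L.idx x) L.baseRep := ⟨x, by simp [baseRep]⟩
  obtain ⟨y, hy, hxy⟩ := exists_label_eq hfix
  have : x = y := hidx (by simpa [baseRep] using hxy)
  rw [step_apply, next_of_fixes hfix, hy, this]

end DihedralLift

open Classical in
/-- The Coxeter matrix of a labelled defining graph. -/
noncomputable def artinCoxeterMatrix {S : Type*} (m : S → S → ℕ) (hsymm : ∀ i j, m i j = m j i) :
    CoxeterMatrix S where
  M := fun i j => if i = j then 1 else if m i j = 1 then 0 else m i j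
  isSymm := Matrix.IsSymm.ext fun i j => by simp [hsymm i j, eq_comm]
  diagonal := by simp
  off_diagonal i j hij := by
    rw [if_neg hij]
    split_ifs with h
    exacts [zero_ne_one, h]

lemma artinCoxeterMatrix_apply {S : Type*} (m : S → S → ℕ) (hsymm : ∀ i j, m i j = m j i)
    {i j : S} (hij : i ≠ j) (hm : 2 ≤ m i j) : artinCoxeterMatrix m hsymm i j = m i j := by
  simp only [artinCoxeterMatrix]
  rw [if_neg hij, if_neg (by omega)]

lemma altG_artinA_artinB (n : ℕ) :
    altG n (artinA n) (artinB n) = altG n (artinB n) (artinA n) := by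
  have h : PresentedGroup.mk (braidRels n) (altG n (FreeGroup.of true) (FreeGroup.of false)) =
      PresentedGroup.mk (braidRels n) (altG n (FreeGroup.of false) (FreeGroup.of true)) :=
    PresentedGroup.mk_eq_mk_of_mul_inv_mem rfl
  rw [map_altG, map_altG] at h
  exact h

namespace CoxeterSystem

variable {B : Type*} {M : CoxeterMatrix B} {W : Type*} [Group W] (cs : CoxeterSystem M W)

lemma simple_ne_simple {i j : B} (hij : i ≠ j) (hM : M i j ≠ 0) :
    cs.simple i ≠ cs.simple j := by
  intro h
  have := cs.dvd_of_simple_mul_simple_pow_eq_one hij hM (k := 1) (by simp [h])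
  exact M.off_diagonal i j hij (Nat.dvd_one.mp this)

/-- The two-generator Artin group attached to two simple reflections. -/
def artinTwoLift {a b : B} (hab : a ≠ b) (hM : M a b ≠ 0) :
    DihedralLift cs (ArtinTwo (M a b)) where
  idx x := cond x a b
  gen := PresentedGroup.of
  proj := PresentedGroup.toGroup (f := fun x => cs.simple (cond x a b)) (by
    rintro r rfl
    rw [map_mul, map_inv, map_altG, map_altG, mul_inv_eq_one, FreeGroup.lift_apply_of,
      FreeGroup.lift_apply_of]
    exact (cs.altG_simple_eq_swap_iff a b _).mpr (cs.simple_mul_simple_pow a b))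
  proj_gen x := PresentedGroup.toGroup.of _
  proj_mem g := by
    refine PresentedGroup.generated_by _ ((cs.parabolic _).comap _) (fun x => ?_) g
    rw [Subgroup.mem_comap, PresentedGroup.toGroup.of]
    exact cs.simple_mem_parabolic ⟨x, rfl⟩
  altG_gen x k h := by
    have hk (k : ℕ) (h : altG k (cs.simple a) (cs.simple b) = altG k (cs.simple b) (cs.simple a)) :
        altG k (artinA (M a b)) (artinB _) = altG k (artinB _) (artinA _) := by
      obtain ⟨c, rfl⟩ := cs.dvd_of_simple_mul_simple_pow_eq_one hab hM
        ((cs.altG_simple_eq_swap_iff a b k).mp h)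
      exact altG_mul_comm (altG_artinA_artinB _) c
    cases x with
    | true => exact hk k h
    | false => exact (hk k h.symm).symm

end CoxeterSystem

/-- A homomorphism from the Artin group to the permutations of the pairs of a coset and an element
of a rank two group. -/
lemma DihedralLift.exists_stepHom {S : Type*} {m : S → S → ℕ} {hsymm : ∀ i j, m i j = m j i}
    (hdiag : ∀ i, m i i = 1) {W : Type*} [Group W]
    {cs : CoxeterSystem (artinCoxeterMatrix m hsymm) W} {A : Type*} [Group A]
    (L : DihedralLift cs A) : ∃ ψ : ArtinGroup m →* Equiv.Perm (L.MinRep × A),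
      ∀ i, ψ (PresentedGroup.of i) = L.step i := by
  refine ⟨PresentedGroup.toGroup (f := L.step) ?_, fun i => PresentedGroup.toGroup.of _⟩
  intro r hr
  simp only [artinRels, Set.mem_iUnion, Set.mem_singleton_iff] at hr
  obtain ⟨i, j, hm, rfl⟩ := hr
  have hij : i ≠ j := by
    rintro rfl
    rw [hdiag] at hm
    omega
  have hM := artinCoxeterMatrix_apply m hsymm hij hm
  rw [map_mul, map_inv, map_altG, map_altG, mul_inv_eq_one, FreeGroup.lift_apply_of,
    FreeGroup.lift_apply_of, ← hM]
  exact altG_step_eq hij (by omega)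

/-- if the defining graph has an edge `(a,b)` labelled `n`, then any
homomorphism from the two-generator Artin group `A_n` sending the generators to the
corresponding generators of the big Artin group is injective, i.e. the special subgroup
generated by `a` and `b` is naturally isomorphic to the two-generator Artin group. -/
theorem artin_special_subgroup_embeds {S : Type*} (m : S → S → ℕ)
    (hsymm : ∀ i j, m i j = m j i) (hdiag : ∀ i, m i i = 1)
    (a b : S) (hab : a ≠ b) (n : ℕ) (hn : 2 ≤ n) (hlabel : m a b = n)
    (φ : ArtinTwo n →* ArtinGroup m)
    (ha : φ (artinA n) = PresentedGroup.of a) (hb : φ (artinB n) = PresentedGroup.of b) :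
    Function.Injective φ := by
  have hM := artinCoxeterMatrix_apply m hsymm hab (hlabel ▸ hn)
  rw [hlabel] at hM
  subst hM
  let cs := (artinCoxeterMatrix m hsymm).toCoxeterSystem
  let L := cs.artinTwoLift hab (by omega)
  obtain ⟨ψ, hψ⟩ := L.exists_stepHom hdiag
  have hne : cs.simple a ≠ cs.simple b := cs.simple_ne_simple hab (by omega)
  have hidx : Function.Injective fun x => cs.simple (L.idx x) := by
    rintro (_ | _) (_ | _) h
    exacts [rfl, (hne h.symm).elim, (hne h).elim, rfl]
  have hφ (x : Bool) : φ (L.gen x) = PresentedGroup.of (L.idx x) := by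
    cases x
    exacts [hb, ha]
  let H : Subgroup (ArtinTwo (artinCoxeterMatrix m hsymm a b)) :=
    { carrier := {x | ∀ g, ψ (φ x) (L.baseRep, g) = (L.baseRep, x * g)}
      one_mem' := by simp
      mul_mem' := fun {x y} hx hy g => by
        rw [map_mul, map_mul, Equiv.Perm.mul_apply, hy, hx, mul_assoc]
      inv_mem' := fun {x} hx g => by
        rw [map_inv, map_inv, Equiv.Perm.inv_eq_iff_eq, hx, mul_inv_cancel_left] }
  have hH : ∀ x, x ∈ H := PresentedGroup.generated_by _ H fun x g => by
    rw [show PresentedGroup.of x = L.gen x from rfl, hφ, hψ, DihedralLift.step_idx_baseRep hidx]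
  intro x y hxy
  have hx := hH x 1
  rw [hxy, hH y 1] at hx
  simpa using (congrArg Prod.snd hx).symm
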